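/- arXiv:2106.12670 — 7 statements merged into one kernel-verified Lean document; each statement's English description precedes it below -/
import Mathlib

section
/- For any compact sets S₁, S₂ ⊆ ℝⁿ, one has \underline{Cont}_d(S₁) + \underline{Cont}_d(S₂) ≤ \underline{Cont}_d(S₁ ∪ S₂) + lim_{ε→0⁺} \overline{Cont}_d(S₁ ∩ B(S₁ ∩ S₂, ε)), where the limit over ε → 0⁺ exists because the quantity \overline{Cont}_d(S₁ ∩ B(S₁ ∩ S₂, ε)) is nondecreasing in ε (so the limit equals the infimum over ε > 0). -/
open MeasureTheory Filter Metric Set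
open scoped ENNReal Topology NNReal

/-- `Cont_d(S;r) = r^(d-n) λⁿ(B(S,r))`, where `B(S,r)` is the closed `r`-neighborhood. -/
noncomputable def contApprox (n : ℕ) (d : ℝ) (S : Set (EuclideanSpace ℝ (Fin n))) (r : ℝ) :
    ℝ≥0∞ :=
  ENNReal.ofReal (r ^ (d - (n : ℝ))) * volume (cthickening r S)

/-- Upper `d`-dimensional Minkowski content. -/
noncomputable def upperCont (n : ℕ) (d : ℝ) (S : Set (EuclideanSpace ℝ (Fin n))) : ℝ≥0∞ :=
  Filter.limsup (contApprox n d S) (𝓝[>] (0 : ℝ))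

/-- Lower `d`-dimensional Minkowski content. -/
noncomputable def lowerCont (n : ℕ) (d : ℝ) (S : Set (EuclideanSpace ℝ (Fin n))) : ℝ≥0∞ :=
  Filter.liminf (contApprox n d S) (𝓝[>] (0 : ℝ))

/-- The `d`-dimensional Minkowski content of `S` exists and equals `c`. -/
def ContEq (n : ℕ) (d : ℝ) (S : Set (EuclideanSpace ℝ (Fin n))) (c : ℝ≥0∞) : Prop :=
  upperCont n d S = c ∧ lowerCont n d S = c

/-- The relative boundary `∂_S T = S ∩ cl(T) ∩ cl(S \ T)` of `T` in `S`. -/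
def relBdry {X : Type*} [TopologicalSpace X] (S T : Set X) : Set X :=
  S ∩ closure T ∩ closure (S \ T)

/-- `𝓜`: sets expressible as the intersection of an open set with a closed set. -/
def MemM (n : ℕ) (S : Set (EuclideanSpace ℝ (Fin n))) : Prop :=
  ∃ U F : Set (EuclideanSpace ℝ (Fin n)), IsOpen U ∧ IsClosed F ∧ S = U ∩ F

/-- `μ` is the `d`-dimensional Minkowski content measure on `S`. -/
def IsMinkowskiMeasure (n : ℕ) (d : ℝ) (S : Set (EuclideanSpace ℝ (Fin n)))
    (μ : Measure (EuclideanSpace ℝ (Fin n))) : Prop :=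
  μ Sᶜ = 0 ∧ ∀ K : Set (EuclideanSpace ℝ (Fin n)), K ⊆ S → IsCompact K →
    μ K < ⊤ ∧ (μ (relBdry S K) = 0 → ContEq n d K (μ K))

theorem liminf_add_liminf_le_liminf_add_limsup {α : Type*} {F : Filter α} {f g h k : α → ℝ≥0∞}
    (hle : ∀ᶠ x in F, f x + g x ≤ h x + k x) :
    liminf f F + liminf g F ≤ liminf h F + limsup k F := by
  rw [limsup_eq_iInf_iSup, ENNReal.add_iInf₂]
  refine le_iInf₂ fun s hs ↦ ?_
  rw [liminf_eq_iSup_iInf (u := f), liminf_eq_iSup_iInf (u := g)]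
  refine ENNReal.biSup_add_biSup_le' ⟨univ, univ_mem⟩ ⟨univ, univ_mem⟩ fun t ht u hu ↦ ?_
  rw [← tsub_le_iff_right]
  refine le_liminf_of_le (by isBoundedDefault) ?_
  filter_upwards [hle, hs, ht, hu] with x hx hxs hxt hxu
  rw [tsub_le_iff_right]
  exact (add_le_add (biInf_le f hxt) (biInf_le g hxu)).trans
    (hx.trans (add_le_add le_rfl (le_biSup k hxs)))

theorem contApprox_mono (n : ℕ) (d r : ℝ) {S T : Set (EuclideanSpace ℝ (Fin n))} (h : S ⊆ T) :
    contApprox n d S r ≤ contApprox n d T r :=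
  mul_le_mul_right (measure_mono (cthickening_subset_of_subset r h)) _

theorem upperCont_mono (n : ℕ) (d : ℝ) {S T : Set (EuclideanSpace ℝ (Fin n))} (h : S ⊆ T) :
    upperCont n d S ≤ upperCont n d T :=
  limsup_le_limsup (Eventually.of_forall fun r ↦ contApprox_mono n d r h)

theorem contApprox_add_le (n : ℕ) (d r : ℝ) {S T A : Set (EuclideanSpace ℝ (Fin n))}
    (h : cthickening r S ∩ cthickening r T ⊆ cthickening r A) :
    contApprox n d S r + contApprox n d T r ≤ contApprox n d (S ∪ T) r + contApprox n d A r := by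
  simp only [contApprox, ← mul_add]
  rw [← measure_union_add_inter (cthickening r S) isClosed_cthickening.measurableSet,
    ← cthickening_union]
  gcongr

theorem eventually_cthickening_inter_cthickening_subset {X : Type*} [PseudoMetricSpace X]
    {S T : Set X} (hS : IsCompact S) (hT : IsClosed T) {ε : ℝ} (hε : 0 < ε) :
    ∀ᶠ r in 𝓝[>] (0 : ℝ), cthickening r S ∩ cthickening r T ⊆
      cthickening r (S ∩ cthickening ε (S ∩ T)) := by
  have hdisj : Disjoint (S \ thickening ε (S ∩ T)) T := disjoint_left.2 fun x hx hxT ↦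
    hx.2 (self_subset_thickening hε _ ⟨hx.1, hxT⟩)
  obtain ⟨δ, hδ, hsep⟩ := hdisj.exists_cthickenings (hS.diff isOpen_thickening) hT
  filter_upwards [Ioo_mem_nhdsGT hδ] with r hr x hx
  have hcover : S ⊆ S \ thickening ε (S ∩ T) ∪ S ∩ cthickening ε (S ∩ T) := fun y hy ↦ by
    by_cases hyt : y ∈ thickening ε (S ∩ T)
    · exact Or.inr ⟨hy, thickening_subset_cthickening _ _ hyt⟩
    · exact Or.inl ⟨hy, hyt⟩
  have hx' := cthickening_subset_of_subset r hcover hx.1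
  rw [cthickening_union] at hx'
  exact hx'.resolve_left fun hxS ↦ disjoint_left.1 hsep
    (cthickening_mono hr.2.le _ hxS) (cthickening_mono hr.2.le _ hx.2)

/-- superadditivity-type bound for the lower Minkowski content of compact sets,
with the error term `lim_(ε→0⁺) upperCont (S₁ ∩ B(S₁ ∩ S₂, ε))`, which exists and equals the
infimum over `ε > 0` since the quantity is nondecreasing in `ε`. -/
theorem lowerCont_add_le_union (n : ℕ) (hn : 1 ≤ n) (d : ℝ) (hd0 : 0 < d) (hdn : d < n)
    (S₁ S₂ : Set (EuclideanSpace ℝ (Fin n))) (h1 : IsCompact S₁) (h2 : IsCompact S₂) :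
    Tendsto (fun ε : ℝ => upperCont n d (S₁ ∩ cthickening ε (S₁ ∩ S₂))) (𝓝[>] (0 : ℝ))
      (𝓝 (⨅ (ε : ℝ) (_ : 0 < ε), upperCont n d (S₁ ∩ cthickening ε (S₁ ∩ S₂)))) ∧
    lowerCont n d S₁ + lowerCont n d S₂ ≤
      lowerCont n d (S₁ ∪ S₂) +
        ⨅ (ε : ℝ) (_ : 0 < ε), upperCont n d (S₁ ∩ cthickening ε (S₁ ∩ S₂)) := by
  constructor
  · have hmono : Monotone fun ε : ℝ ↦ upperCont n d (S₁ ∩ cthickening ε (S₁ ∩ S₂)) :=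
      fun a b hab ↦ upperCont_mono n d (inter_subset_inter_right _ (cthickening_mono hab _))
    simpa only [sInf_image, mem_Ioi] using hmono.tendsto_nhdsGT 0
  · rw [ENNReal.add_iInf₂]
    refine le_iInf₂ fun ε hε ↦ liminf_add_liminf_le_liminf_add_limsup ?_
    filter_upwards [eventually_cthickening_inter_cthickening_subset h1 h2.isClosed hε] with r hr
    exact contApprox_add_le n d r hr
end

section
/- Let S₁, S₂ ⊆ ℝⁿ be compact and let ε > 0. Then there exists δ > 0 such that for all r ∈ (0, δ), the intersection of the closed r-neighborhoods satisfies B(S₁, r) ∩ B(S₂, r) ⊆ B(S₁ ∩ B(S₁ ∩ S₂, ε), r). -/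
open MeasureTheory Filter Metric Set
open scoped ENNReal Topology NNReal

/-- for compact `S₁, S₂` and `ε > 0`, for all sufficiently small `r > 0`,
`B(S₁,r) ∩ B(S₂,r) ⊆ B(S₁ ∩ B(S₁ ∩ S₂, ε), r)`. -/
theorem inter_cthickening_subset (n : ℕ) (S₁ S₂ : Set (EuclideanSpace ℝ (Fin n)))
    (h1 : IsCompact S₁) (h2 : IsCompact S₂) (ε : ℝ) (hε : 0 < ε) :
    ∃ δ > 0, ∀ r ∈ Ioo (0 : ℝ) δ,
      cthickening r S₁ ∩ cthickening r S₂ ⊆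
        cthickening r (S₁ ∩ cthickening ε (S₁ ∩ S₂)) := by
  have hdisj : Disjoint (S₁ \ thickening ε (S₁ ∩ S₂)) S₂ :=
    disjoint_left.2 fun _ hx hx₂ => hx.2 (self_subset_thickening hε _ ⟨hx.1, hx₂⟩)
  obtain ⟨δ, hδ, hd⟩ := hdisj.exists_cthickenings (h1.diff isOpen_thickening) h2.isClosed
  refine ⟨δ, hδ, fun r hr x hx => ?_⟩
  have hx₁ := hx.1
  rw [h1.cthickening_eq_biUnion_closedBall hr.1.le] at hx₁
  obtain ⟨y, hy, hxy⟩ := mem_iUnion₂.1 hx₁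
  by_cases hyt : y ∈ thickening ε (S₁ ∩ S₂)
  · exact mem_cthickening_of_dist_le x y r _ ⟨hy, thickening_subset_cthickening _ _ hyt⟩ hxy
  · exact absurd (cthickening_mono hr.2.le _ hx.2) (disjoint_left.1 hd
      (cthickening_mono hr.2.le _ (mem_cthickening_of_dist_le x y r _ ⟨hy, hyt⟩ hxy)))
end

section
/- The d-dimensional Minkowski content measure on any S ∈ 𝓜 is unique when it exists: if μ₁ and μ₂ are both d-dimensional Minkowski content measures on S, then μ₁ = μ₂. -/
open MeasureTheory Filter Metric Set
open scoped ENNReal Topology NNReal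

theorem ContEq.unique {n : ℕ} {d : ℝ} {S : Set (EuclideanSpace ℝ (Fin n))} {a b : ℝ≥0∞}
    (ha : ContEq n d S a) (hb : ContEq n d S b) : a = b :=
  ha.1.symm.trans hb.1

/-- The relative boundary in `S` of a compact trace of a closed thickening lies on a level set of
the distance function. -/
theorem relBdry_inter_cthickening_subset {X : Type*} [PseudoMetricSpace X] (S K : Set X) {r : ℝ}
    (hr : 0 ≤ r) (hclosed : IsClosed (S ∩ cthickening r K)) :
    relBdry S (S ∩ cthickening r K) ⊆ {x | infDist x K = r} ∩ (S ∩ cthickening r K) := by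
  rintro x ⟨⟨-, hx⟩, hx'⟩
  rw [hclosed.closure_eq] at hx
  have hsub : S \ (S ∩ cthickening r K) ⊆ {y | ENNReal.ofReal r ≤ infEDist y K} := by
    rintro y ⟨hyS, hy⟩
    by_contra hlt
    exact hy ⟨hyS, mem_cthickening_iff.2 (not_le.mp hlt).le⟩
  have hge : ENNReal.ofReal r ≤ infEDist x K :=
    closure_minimal hsub (isClosed_le continuous_const continuous_infEDist) hx'
  have heq : infEDist x K = ENNReal.ofReal r := le_antisymm hx.2 hge
  exact ⟨by simp [infDist, heq, hr], hx⟩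

/-- Finite measures have arbitrarily small radii whose level sets of the distance function are
null. -/
theorem frequently_measure_infDist_eq_zero {X : Type*} [PseudoMetricSpace X] [MeasurableSpace X]
    [BorelSpace X] (ν : Measure X) [IsFiniteMeasure ν] (K : Set X) :
    ∃ᶠ r in 𝓝[>] (0 : ℝ), ν {x | infDist x K = r} = 0 := by
  have hcount : {r : ℝ | 0 < ν {x | infDist x K = r}}.Countable :=
    Measure.countable_meas_level_set_pos (continuous_infDist_pt K).measurable
  rw [(nhdsGT_basis (0 : ℝ)).frequently_iff]
  intro ε hε
  obtain ⟨r, hr, hrε⟩ := (hcount.dense_compl ℝ).exists_between hε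
  exact ⟨r, hrε, by simpa using hr⟩

/-- Minkowski content measures agree on compact subsets. -/
theorem IsMinkowskiMeasure.measure_eq_of_isCompact {n : ℕ} {d : ℝ}
    {S : Set (EuclideanSpace ℝ (Fin n))} (hS : MemM n S)
    {μ₁ μ₂ : Measure (EuclideanSpace ℝ (Fin n))}
    (h1 : IsMinkowskiMeasure n d S μ₁) (h2 : IsMinkowskiMeasure n d S μ₂)
    {K : Set (EuclideanSpace ℝ (Fin n))} (hKS : K ⊆ S) (hK : IsCompact K) :
    μ₁ K = μ₂ K := by
  obtain ⟨U, F, hU, hF, rfl⟩ := hS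
  obtain ⟨δ, hδ, hδU⟩ := hK.exists_cthickening_subset_open hU (hKS.trans inter_subset_left)
  have hcompact : ∀ r ≤ δ, IsCompact (U ∩ F ∩ cthickening r K) := by
    intro r hr
    have heq : U ∩ F ∩ cthickening r K = F ∩ cthickening r K := by
      rw [inter_assoc, inter_eq_right]
      exact inter_subset_right.trans ((cthickening_mono hr K).trans hδU)
    rw [heq]
    exact hK.cthickening.inter_left hF
  set A := U ∩ F ∩ cthickening δ K with hA
  have hAc : IsCompact A := hcompact δ le_rfl
  have hAS : A ⊆ U ∩ F := inter_subset_left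
  have : IsFiniteMeasure (μ₁.restrict A) := isFiniteMeasure_restrict.2 (h1.2 A hAS hAc).1.ne
  have : IsFiniteMeasure (μ₂.restrict A) := isFiniteMeasure_restrict.2 (h2.2 A hAS hAc).1.ne
  have hKA : K ⊆ A := subset_inter hKS (self_subset_cthickening K)
  have hlim : ∀ (μ : Measure (EuclideanSpace ℝ (Fin n))), IsFiniteMeasure (μ.restrict A) →
      Tendsto (fun r => μ.restrict A (cthickening r K)) (𝓝[>] 0) (𝓝 (μ K)) := by
    intro μ _
    have h := tendsto_measure_cthickening_of_isClosed (μ := μ.restrict A)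
      ⟨1, one_pos, measure_ne_top _ _⟩ hK.isClosed
    rw [Measure.restrict_eq_self μ hKA] at h
    exact h.mono_left nhdsWithin_le_nhds
  refine tendsto_nhds_unique_of_frequently_eq (hlim μ₁ ‹_›) (hlim μ₂ ‹_›) ?_
  have hsmall : ∀ᶠ r in 𝓝[>] (0 : ℝ), r ∈ Ioo 0 δ := Ioo_mem_nhdsGT hδ
  refine ((frequently_measure_infDist_eq_zero (μ₁.restrict A + μ₂.restrict A) K).and_eventually
    hsmall).mono ?_
  rintro r ⟨hr, hr0, hrδ⟩
  rw [Measure.add_apply, add_eq_zero] at hr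
  have hrA : U ∩ F ∩ cthickening r K ⊆ A := inter_subset_inter_right _ (cthickening_mono hrδ.le K)
  have hrc := hcompact r hrδ.le
  have hsub : relBdry (U ∩ F) (U ∩ F ∩ cthickening r K) ⊆ {x | infDist x K = r} ∩ A :=
    (relBdry_inter_cthickening_subset _ K hr0.le hrc.isClosed).trans
      (inter_subset_inter_right _ hrA)
  have heq : cthickening r K ∩ A = U ∩ F ∩ cthickening r K := by
    refine Subset.antisymm (fun x hx => ⟨hx.2.1, hx.1⟩) (fun x hx => ⟨hx.2, hrA hx⟩)
  have hnull : ∀ μ : Measure (EuclideanSpace ℝ (Fin n)),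
      μ.restrict A {x | infDist x K = r} = 0 →
        μ (relBdry (U ∩ F) (U ∩ F ∩ cthickening r K)) = 0 := by
    intro μ h
    rw [Measure.restrict_apply' hAc.measurableSet] at h
    exact measure_mono_null hsub h
  simp only [Measure.restrict_apply' hAc.measurableSet, heq]
  exact ((h1.2 _ inter_subset_left hrc).2 (hnull μ₁ hr.1)).unique
    ((h2.2 _ inter_subset_left hrc).2 (hnull μ₂ hr.2))

/-- An intersection of an open set with a closed set is a countable union of compact sets. -/
theorem MemM.exists_iUnion_isCompact {n : ℕ} {S : Set (EuclideanSpace ℝ (Fin n))}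
    (hS : MemM n S) :
    ∃ C : ℕ × ℕ → Set (EuclideanSpace ℝ (Fin n)), (∀ i, IsCompact (C i)) ∧ ⋃ i, C i = S := by
  obtain ⟨U, F, hU, hF, rfl⟩ := hS
  obtain ⟨G, hG, -, rfl, -⟩ := hU.exists_iUnion_isClosed
  refine ⟨fun i => compactCovering (EuclideanSpace ℝ (Fin n)) i.2 ∩ (G i.1 ∩ F),
    fun i => (isCompact_compactCovering _ _).inter_right ((hG _).inter hF), ?_⟩
  ext x
  obtain ⟨k, hk⟩ := exists_mem_compactCovering x
  simp only [mem_iUnion, mem_inter_iff, Prod.exists]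
  exact ⟨fun ⟨a, _, _, ha, hF⟩ => ⟨⟨a, ha⟩, hF⟩, fun ⟨⟨a, ha⟩, hF⟩ => ⟨a, k, hk, ha, hF⟩⟩

/-- uniqueness of the Minkowski content measure. -/
theorem minkowskiMeasure_unique (n : ℕ) (hn : 1 ≤ n) (d : ℝ) (hd0 : 0 < d) (hdn : d < n)
    (S : Set (EuclideanSpace ℝ (Fin n))) (hS : MemM n S)
    (μ₁ μ₂ : Measure (EuclideanSpace ℝ (Fin n)))
    (h1 : IsMinkowskiMeasure n d S μ₁) (h2 : IsMinkowskiMeasure n d S μ₂) :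
    μ₁ = μ₂ := by
  rw [← Measure.restrict_eq_self_of_ae_mem (mem_ae_iff.2 h1.1),
    ← Measure.restrict_eq_self_of_ae_mem (mem_ae_iff.2 h2.1)]
  obtain ⟨C, hC, hCS⟩ := hS.exists_iUnion_isCompact
  rw [← hCS, Measure.restrict_iUnion_congr]
  intro i
  have hsub : C i ⊆ S := hCS ▸ subset_iUnion C i
  have : IsFiniteMeasure (μ₁.restrict (C i)) :=
    isFiniteMeasure_restrict.2 (h1.2 _ hsub (hC i)).1.ne
  refine ext_of_generate_finite {s | IsClosed s}
    (by rw [BorelSpace.measurable_eq (α := EuclideanSpace ℝ (Fin n)),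
      borel_eq_generateFrom_isClosed]) isPiSystem_isClosed ?_ ?_
  · intro s hs
    rw [Measure.restrict_apply' (hC i).measurableSet, Measure.restrict_apply' (hC i).measurableSet]
    exact h1.measure_eq_of_isCompact hS h2 (inter_subset_right.trans hsub) ((hC i).inter_left hs)
  · simpa using h1.measure_eq_of_isCompact hS h2 hsub (hC i)
end

section
/- Let S ⊆ ℝⁿ be compact and let μ be a Borel measure on ℝⁿ with μ(ℝⁿ \ S) = 0. If the d-dimensional Minkowski content Cont_d(S) exists, equals μ(S), and is finite, and if for every compact set K ⊆ S one has \overline{Cont}_d(K) ≤ μ(K), then μ is the d-dimensional Minkowski content measure on S. -/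
open MeasureTheory Filter Metric Set
open scoped ENNReal Topology NNReal

theorem ENNReal.liminf_add_le_liminf_add_limsup {ι : Type*} {f : Filter ι} [f.NeBot]
    (u v : ι → ℝ≥0∞) : liminf (fun i => u i + v i) f ≤ liminf u f + limsup v f := by
  refine ENNReal.le_of_forall_pos_le_add fun ε hε hlt => ?_
  have htop : limsup v f ≠ ⊤ := (ENNReal.add_lt_top.1 hlt).2.ne
  have hv : ∀ᶠ i in f, v i < limsup v f + ε :=
    eventually_lt_of_limsup_lt (ENNReal.lt_add_right htop (by exact_mod_cast hε.ne'))
  calc liminf (fun i => u i + v i) f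
      ≤ liminf (fun i => u i + (limsup v f + ε)) f :=
        liminf_le_liminf (hv.mono fun i hi => by gcongr)
    _ = liminf u f + (limsup v f + ε) :=
        liminf_add_const f u _ (by isBoundedDefault) (by isBoundedDefault)
    _ = liminf u f + limsup v f + ε := (add_assoc _ _ _).symm

theorem contApprox_union_le (n : ℕ) (d : ℝ) (S T : Set (EuclideanSpace ℝ (Fin n))) (r : ℝ) :
    contApprox n d (S ∪ T) r ≤ contApprox n d S r + contApprox n d T r := by
  rw [contApprox, contApprox, contApprox, cthickening_union, ← mul_add]
  gcongr
  exact measure_union_le _ _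

theorem lowerCont_le_upperCont (n : ℕ) (d : ℝ) (S : Set (EuclideanSpace ℝ (Fin n))) :
    lowerCont n d S ≤ upperCont n d S :=
  liminf_le_limsup

theorem lowerCont_union_le (n : ℕ) (d : ℝ) (S T : Set (EuclideanSpace ℝ (Fin n))) :
    lowerCont n d (S ∪ T) ≤ lowerCont n d S + upperCont n d T :=
  (liminf_le_liminf (Eventually.of_forall fun r => contApprox_union_le n d S T r)).trans
    (ENNReal.liminf_add_le_liminf_add_limsup _ _)

/-- a criterion for being the Minkowski content measure on a compact set. -/
theorem isMinkowskiMeasure_of_compact (n : ℕ) (hn : 1 ≤ n) (d : ℝ) (hd0 : 0 < d) (hdn : d < n)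
    (S : Set (EuclideanSpace ℝ (Fin n))) (hS : IsCompact S)
    (μ : Measure (EuclideanSpace ℝ (Fin n))) (hsupp : μ Sᶜ = 0)
    (hCont : ContEq n d S (μ S)) (hfin : μ S < ⊤)
    (hupper : ∀ K : Set (EuclideanSpace ℝ (Fin n)), K ⊆ S → IsCompact K → upperCont n d K ≤ μ K) :
    IsMinkowskiMeasure n d S μ := by
  refine ⟨hsupp, fun K hKS hK => ⟨(measure_mono hKS).trans_lt hfin, fun hbd => ?_⟩⟩
  set L := closure (S \ K)
  have hLS : L ⊆ S := closure_minimal sdiff_subset hS.isClosed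
  have hL : IsCompact L := hS.of_isClosed_subset isClosed_closure hLS
  have hunion : K ∪ L = S :=
    (union_subset hKS hLS).antisymm fun x hx =>
      (em (x ∈ K)).imp_right fun hxK => subset_closure ⟨hx, hxK⟩
  have hLK : μ (L ∩ K) = 0 :=
    measure_mono_null (t := relBdry S K)
      (fun x hx => ⟨⟨hKS hx.2, subset_closure hx.2⟩, hx.1⟩) hbd
  have hμ : μ K + μ L ≤ μ S := by
    rw [← measure_inter_add_sdiff L hK.measurableSet, hLK, zero_add,
      ← measure_inter_add_sdiff S hK.measurableSet, inter_eq_right.2 hKS]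
    gcongr
  have hlow : μ K + μ L ≤ lowerCont n d K + μ L :=
    calc μ K + μ L ≤ lowerCont n d S := hμ.trans_eq hCont.2.symm
      _ = lowerCont n d (K ∪ L) := by rw [hunion]
      _ ≤ lowerCont n d K + upperCont n d L := lowerCont_union_le n d K L
      _ ≤ lowerCont n d K + μ L := by gcongr; exact hupper L hLS hL
  have hle : μ K ≤ lowerCont n d K :=
    (ENNReal.add_le_add_iff_right ((measure_mono hLS).trans_lt hfin).ne).1 hlow
  have hup := hupper K hKS hK
  have hlu := lowerCont_le_upperCont n d K
  exact ⟨hup.antisymm (hle.trans hlu), (hlu.trans hup).antisymm hle⟩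
end

section
/- Let S ⊆ ℝⁿ be compact, and for r > 0 let μ_r be the measure on ℝⁿ with density r^{d-n} 1_{B(S,r)} with respect to Lebesgue measure λⁿ. If μ is the d-dimensional Minkowski content measure on S (in particular μ is finite), then μ_r converges weakly to μ as r → 0⁺, i.e., ∫ f dμ_r → ∫ f dμ for every bounded continuous f : ℝⁿ → ℝ. -/
open MeasureTheory Filter Metric Set
open scoped ENNReal Topology NNReal

/-- The measure `μ_r` with density `r^(d-n) 1_(B(S,r))` with respect to Lebesgue measure. -/
noncomputable def muApprox (n : ℕ) (d : ℝ) (S : Set (EuclideanSpace ℝ (Fin n))) (r : ℝ) :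
    Measure (EuclideanSpace ℝ (Fin n)) :=
  ENNReal.ofReal (r ^ (d - (n : ℝ))) • (volume.restrict (cthickening r S))

namespace MeasureTheory

variable {Ω ι : Type*} [MeasurableSpace Ω] [TopologicalSpace Ω] [OpensMeasurableSpace Ω]

/-- If `μ G ≤ liminf ν i G` for all open sets `G`, then the integral of a nonnegative bounded
continuous function is lower semicontinuous along `ν`. -/
lemma eventually_lt_integral_of_forall_isOpen_le_liminf {μ : Measure Ω} [IsFiniteMeasure μ]
    {ν : ι → Measure Ω} [∀ i, IsFiniteMeasure (ν i)] {L : Filter ι} [L.IsCountablyGenerated]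
    (h_opens : ∀ G, IsOpen G → μ G ≤ L.liminf (fun i ↦ ν i G))
    {f : BoundedContinuousFunction Ω ℝ} (hf : 0 ≤ f) {a : ℝ} (ha : a < ∫ x, f x ∂μ) :
    ∀ᶠ i in L, a < ∫ x, f x ∂(ν i) := by
  have h_nonneg : ∀ i, 0 ≤ ∫ x, f x ∂(ν i) := fun i ↦ integral_nonneg hf
  rcases lt_or_ge a 0 with ha0 | ha0
  · exact .of_forall fun i ↦ ha0.trans_le (h_nonneg i)
  have h_ofReal : ∀ (m : Measure Ω) [IsFiniteMeasure m],
      ENNReal.ofReal (∫ x, f x ∂m) = ∫⁻ x, ENNReal.ofReal (f x) ∂m := fun m _ ↦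
    ofReal_integral_eq_lintegral_ofReal (f.integrable m) (.of_forall hf)
  refine eventually_iff_seq_eventually.2 fun u hu ↦ ?_
  have key := lintegral_le_liminf_lintegral_of_forall_isOpen_measure_le_liminf_measure
    (μ := μ) (μs := fun k ↦ ν (u k)) f.continuous hf
    fun G hG ↦ (h_opens G hG).trans (liminf_le_liminf_of_le hu)
  simp_rw [← h_ofReal] at key
  have hlt := (ENNReal.ofReal_lt_ofReal_iff_of_nonneg ha0).2 ha
  filter_upwards [eventually_lt_of_lt_liminf (hlt.trans_le key)] with k hk
  exact (ENNReal.ofReal_lt_ofReal_iff_of_nonneg ha0).1 hk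

/-- Portmanteau criterion for finite measures: convergence of the total masses and
`μ G ≤ liminf ν i G` for all open sets `G` imply weak convergence. -/
theorem tendsto_integral_of_forall_isOpen_le_liminf {μ : Measure Ω} [IsFiniteMeasure μ]
    {ν : ι → Measure Ω} [∀ i, IsFiniteMeasure (ν i)] {L : Filter ι} [L.IsCountablyGenerated]
    (h_univ : Tendsto (fun i ↦ ν i univ) L (𝓝 (μ univ)))
    (h_opens : ∀ G, IsOpen G → μ G ≤ L.liminf (fun i ↦ ν i G))
    (f : BoundedContinuousFunction Ω ℝ) :
    Tendsto (fun i ↦ ∫ x, f x ∂(ν i)) L (𝓝 (∫ x, f x ∂μ)) := by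
  have h_real : Tendsto (fun i ↦ (ν i).real univ) L (𝓝 (μ.real univ)) :=
    (ENNReal.tendsto_toReal (measure_ne_top μ univ)).comp h_univ
  have h_lower : ∀ (g : BoundedContinuousFunction Ω ℝ) (a : ℝ), a < ∫ x, g x ∂μ →
      ∀ᶠ i in L, a < ∫ x, g x ∂(ν i) := by
    intro g a ha
    let h := g + BoundedContinuousFunction.const Ω ‖g‖
    have hh : 0 ≤ h := fun x ↦ by
      have := (abs_le.1 (g.norm_coe_le_norm x)).1
      simpa [h] using neg_le_iff_add_nonneg.1 this
    have h_int : ∀ (m : Measure Ω) [IsFiniteMeasure m],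
        ∫ x, h x ∂m = ∫ x, g x ∂m + m.real univ * ‖g‖ := fun m _ ↦ by
      simp [h, integral_add (g.integrable m) (integrable_const _)]
    obtain ⟨b, hab, hb⟩ := exists_between ha
    have h_mass : ∀ᶠ i in L, (ν i).real univ * ‖g‖ < μ.real univ * ‖g‖ + (b - a) :=
      (h_real.mul_const ‖g‖).eventually_lt_const (by linarith)
    have h_event := eventually_lt_integral_of_forall_isOpen_le_liminf h_opens hh
      (a := b + μ.real univ * ‖g‖) (by rw [h_int]; linarith)
    filter_upwards [h_mass, h_event] with i hi₁ hi₂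
    rw [h_int] at hi₂
    linarith
  refine tendsto_order.2 ⟨h_lower f, fun a ha ↦ ?_⟩
  filter_upwards [h_lower (-f) (-a) (by simpa [integral_neg] using ha)] with i hi
  simpa [integral_neg] using hi

end MeasureTheory

lemma relBdry_inter_closure_subset_frontier {X : Type*} [TopologicalSpace X] (S T : Set X) :
    relBdry S (S ∩ closure T) ⊆ frontier T := by
  rintro x ⟨⟨-, hx₁⟩, hx₂⟩
  rw [frontier_eq_closure_inter_closure]
  refine ⟨closure_minimal inter_subset_right isClosed_closure hx₁, closure_mono ?_ hx₂⟩
  exact fun y hy hyT ↦ hy.2 ⟨hy.1, subset_closure hyT⟩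

lemma ContEq.tendsto {n : ℕ} {d : ℝ} {K : Set (EuclideanSpace ℝ (Fin n))} {c : ℝ≥0∞}
    (h : ContEq n d K c) : Tendsto (contApprox n d K) (𝓝[>] (0 : ℝ)) (𝓝 c) :=
  tendsto_of_liminf_eq_limsup h.2 h.1

lemma isFiniteMeasure_muApprox (n : ℕ) (d : ℝ) {S : Set (EuclideanSpace ℝ (Fin n))}
    (hS : IsCompact S) (r : ℝ) : IsFiniteMeasure (muApprox n d S r) := by
  refine ⟨?_⟩
  simp only [muApprox, Measure.smul_apply, Measure.restrict_apply_univ, smul_eq_mul]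
  exact ENNReal.mul_lt_top ENNReal.ofReal_lt_top hS.isBounded.cthickening.measure_lt_top

lemma contApprox_le_muApprox {n : ℕ} (d : ℝ) {S K G : Set (EuclideanSpace ℝ (Fin n))}
    {r : ℝ} (hG : MeasurableSet G) (hKS : K ⊆ S) (hKG : cthickening r K ⊆ G) :
    contApprox n d K r ≤ muApprox n d S r G := by
  simp only [contApprox, muApprox, Measure.smul_apply, smul_eq_mul, Measure.restrict_apply hG]
  gcongr
  exact subset_inter hKG (cthickening_subset_of_subset r hKS)

namespace IsMinkowskiMeasure

variable {n : ℕ} {d : ℝ} {S : Set (EuclideanSpace ℝ (Fin n))}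
  {μ : Measure (EuclideanSpace ℝ (Fin n))}

lemma measure_inter_eq (hμ : IsMinkowskiMeasure n d S μ) (A : Set (EuclideanSpace ℝ (Fin n))) :
    μ (S ∩ A) = μ A :=
  measure_congr (by
    filter_upwards [(show ∀ᵐ x ∂μ, x ∈ S from hμ.1)] with x hx
    exact propext ⟨fun h ↦ h.2, fun h ↦ ⟨hx, h⟩⟩)

lemma isFiniteMeasure (hμ : IsMinkowskiMeasure n d S μ) (hS : IsCompact S) :
    IsFiniteMeasure μ :=
  ⟨by simpa [← hμ.measure_inter_eq univ] using (hμ.2 S Subset.rfl hS).1⟩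

lemma tendsto_muApprox_univ (hμ : IsMinkowskiMeasure n d S μ) (hS : IsCompact S) :
    Tendsto (fun r ↦ muApprox n d S r univ) (𝓝[>] (0 : ℝ)) (𝓝 (μ univ)) := by
  have h := ((hμ.2 S Subset.rfl hS).2 (by simp [relBdry])).tendsto
  rw [← hμ.measure_inter_eq univ, inter_univ]
  simpa [muApprox, contApprox, funext_iff] using! h

lemma le_liminf_muApprox (hμ : IsMinkowskiMeasure n d S μ) (hS : IsCompact S)
    {G : Set (EuclideanSpace ℝ (Fin n))} (hG : IsOpen G) :
    μ G ≤ liminf (fun r ↦ muApprox n d S r G) (𝓝[>] (0 : ℝ)) := by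
  have := hμ.isFiniteMeasure hS
  refine le_of_forall_lt fun a ha ↦ ?_
  obtain ⟨K, hKG, hK, haK⟩ := hG.exists_lt_isCompact ha
  obtain ⟨δ, hδ, hδG⟩ := hK.exists_cthickening_subset_open hG hKG
  obtain ⟨t, ⟨ht₀, htδ⟩, ht⟩ := exists_null_frontier_thickening μ K (half_pos hδ)
  set K' := S ∩ closure (thickening t K) with hK'
  have h_cont : ContEq n d K' (μ K') :=
    (hμ.2 K' inter_subset_left (hS.inter_right isClosed_closure)).2
      (measure_mono_null (relBdry_inter_closure_subset_frontier S _) ht)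
  have h_le : μ K ≤ μ K' := by
    rw [hK', hμ.measure_inter_eq]
    exact measure_mono ((self_subset_thickening ht₀ K).trans subset_closure)
  refine (haK.trans_le h_le).trans_le (h_cont.2.symm.le.trans (liminf_le_liminf ?_))
  filter_upwards [Ioo_mem_nhdsGT (half_pos hδ)] with r hr
  refine contApprox_le_muApprox d hG.measurableSet inter_subset_left ?_
  calc cthickening r K' ⊆ cthickening r (cthickening t K) :=
        cthickening_subset_of_subset r
          (inter_subset_right.trans (closure_thickening_subset_cthickening t K))
    _ ⊆ cthickening (r + t) K := cthickening_cthickening_subset hr.1.le ht₀.le K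
    _ ⊆ cthickening δ K := cthickening_mono (by linarith [hr.2]) K
    _ ⊆ G := hδG

end IsMinkowskiMeasure

/-- if `μ` is the Minkowski content measure on the compact set `S`, then `μ_r`
converges weakly to `μ` as `r → 0⁺`. -/
theorem weak_limit_of_isMinkowskiMeasure (n : ℕ) (hn : 1 ≤ n) (d : ℝ) (hd0 : 0 < d) (hdn : d < n)
    (S : Set (EuclideanSpace ℝ (Fin n))) (hS : IsCompact S)
    (μ : Measure (EuclideanSpace ℝ (Fin n))) (hμ : IsMinkowskiMeasure n d S μ) :
    ∀ f : BoundedContinuousFunction (EuclideanSpace ℝ (Fin n)) ℝ,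
      Tendsto (fun r : ℝ => ∫ x, f x ∂(muApprox n d S r)) (𝓝[>] (0 : ℝ))
        (𝓝 (∫ x, f x ∂μ)) := by
  have := hμ.isFiniteMeasure hS
  have := isFiniteMeasure_muApprox n d hS
  exact tendsto_integral_of_forall_isOpen_le_liminf (hμ.tendsto_muApprox_univ hS)
    fun _ hG ↦ hμ.le_liminf_muApprox hS hG
end

section
/- (Restriction property) Let μ be the d-dimensional Minkowski content measure on S ∈ 𝓜. Let F ⊆ ℝⁿ be closed and G ⊆ ℝⁿ be open, and suppose μ(∂_S(S ∩ F)) = 0. Let S' = S ∩ F ∩ G and let μ' be the restriction of μ to S' (i.e., μ'(A) = μ(A ∩ S')). Then S' ∈ 𝓜 and μ' is the d-dimensional Minkowski content measure on S'. -/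
open MeasureTheory Filter Metric Set
open scoped ENNReal Topology NNReal

lemma MemM.inter_isClosed_inter_isOpen {n : ℕ} {S F G : Set (EuclideanSpace ℝ (Fin n))}
    (hS : MemM n S) (hF : IsClosed F) (hG : IsOpen G) : MemM n (S ∩ F ∩ G) := by
  obtain ⟨U, C, hU, hC, rfl⟩ := hS
  exact ⟨U ∩ G, C ∩ F, hU.inter hG, hC.inter hF, by ac_rfl⟩

lemma MemM.measurableSet {n : ℕ} {S : Set (EuclideanSpace ℝ (Fin n))} (hS : MemM n S) :
    MeasurableSet S := by
  obtain ⟨U, C, hU, hC, rfl⟩ := hS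
  exact hU.measurableSet.inter hC.measurableSet

/-- For closed `K ⊆ S ∩ F ∩ G` with `G` open, the boundary of `K` in `S` is covered by the boundary
of `K` in `S ∩ F ∩ G` and the boundary of `S ∩ F` in `S`. -/
lemma relBdry_subset_union {X : Type*} [TopologicalSpace X] {S F G K : Set X} (hG : IsOpen G)
    (hK : IsClosed K) (hKS : K ⊆ S ∩ F ∩ G) :
    relBdry S K ⊆ relBdry (S ∩ F ∩ G) K ∪ relBdry S (S ∩ F) := by
  rintro x ⟨⟨hxS, hxK⟩, hx⟩
  have hx' : x ∈ S ∩ F ∩ G := hKS (hK.closure_eq ▸ hxK)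
  have hcover : S \ K ⊆ (S ∩ F ∩ G) \ K ∪ (S \ (S ∩ F) ∪ Gᶜ) := by
    rintro y ⟨hyS, hyK⟩
    by_cases hyF : y ∈ F <;> by_cases hyG : y ∈ G <;> simp [*]
  have hcl := closure_mono hcover hx
  rw [closure_union, closure_union, hG.isClosed_compl.closure_eq] at hcl
  rcases hcl with h | h | h
  · exact Or.inl ⟨⟨hx', hxK⟩, h⟩
  · exact Or.inr ⟨⟨hxS, subset_closure hx'.1⟩, h⟩
  · exact absurd hx'.2 h

/-- Restriction property: the restriction of a Minkowski content measure to
`S' = S ∩ F ∩ G` (`F` closed, `G` open, `μ(∂_S (S ∩ F)) = 0`) is the Minkowski content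
measure on `S'`. -/
theorem minkowskiMeasure_restriction (n : ℕ) (hn : 1 ≤ n) (d : ℝ) (hd0 : 0 < d) (hdn : d < n)
    (S : Set (EuclideanSpace ℝ (Fin n))) (hS : MemM n S)
    (μ : Measure (EuclideanSpace ℝ (Fin n))) (hμ : IsMinkowskiMeasure n d S μ)
    (F G : Set (EuclideanSpace ℝ (Fin n))) (hF : IsClosed F) (hG : IsOpen G)
    (hbd : μ (relBdry S (S ∩ F)) = 0) :
    MemM n (S ∩ F ∩ G) ∧
      IsMinkowskiMeasure n d (S ∩ F ∩ G) (μ.restrict (S ∩ F ∩ G)) := by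
  have hM := hS.inter_isClosed_inter_isOpen hF hG
  have hmeas := hM.measurableSet
  refine ⟨hM, by simp [Measure.restrict_apply' hmeas], fun K hKS hK => ?_⟩
  obtain ⟨hfin, hcont⟩ := hμ.2 K (fun x hx => (hKS hx).1.1) hK
  rw [Measure.restrict_eq_self μ hKS]
  refine ⟨hfin, fun h0 => hcont ?_⟩
  have hsub : relBdry (S ∩ F ∩ G) K ⊆ S ∩ F ∩ G := fun x hx => hx.1.1
  rw [Measure.restrict_eq_self μ hsub] at h0
  exact measure_mono_null (relBdry_subset_union hG hK.isClosed hKS) (measure_union_null h0 hbd)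
end

section
/- Let G ⊆ ℝⁿ be open and let φ : G → ℝⁿ be injective, continuously differentiable on G, and conformal, meaning there is a function s : G → (0, ∞) such that for every x ∈ G and every vector v ∈ ℝⁿ, ‖Dφ(x)v‖ = s(x)‖v‖. Let K ⊆ G be a nonempty compact set, and set m_K = min_{x∈K} s(x) and M_K = max_{x∈K} s(x). Then m_K^n · M_K^{d-n} · \underline{Cont}_d(K) ≤ \underline{Cont}_d(φ(K)) ≤ \overline{Cont}_d(φ(K)) ≤ M_K^n · m_K^{d-n} · \overline{Cont}_d(K). -/
open MeasureTheory Filter Metric Set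
open scoped ENNReal Topology NNReal

section Conformal

variable {E : Type*} [NormedAddCommGroup E] [NormedSpace ℝ E]

theorem abs_sub_le_norm_sub_of_norm_map_eq_mul [Nontrivial E] {f g : E →L[ℝ] E} {a b : ℝ}
    (hf : ∀ v, ‖f v‖ = a * ‖v‖) (hg : ∀ v, ‖g v‖ = b * ‖v‖) : |a - b| ≤ ‖f - g‖ := by
  obtain ⟨v, hv⟩ := exists_norm_eq E zero_le_one
  calc |a - b| = |‖f v‖ - ‖g v‖| := by rw [hf, hg, hv, mul_one, mul_one]
    _ ≤ ‖(f - g) v‖ := abs_norm_sub_norm_le _ _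
    _ ≤ ‖f - g‖ := by simpa [hv] using (f - g).le_opNorm v

theorem image_cthickening_subset_cthickening {φ : E → E} {φ' : E → E →L[ℝ] E} {s : E → ℝ}
    {K : Set E} (hK : IsCompact K) {c : ℝ≥0} {δ r M : ℝ}
    (happrox : ∀ x ∈ K, ApproximatesLinearOn φ (φ' x) (closedBall x δ) c)
    (hconf : ∀ x ∈ K, ∀ v, ‖φ' x v‖ = s x * ‖v‖) (hM : ∀ x ∈ K, s x ≤ M)
    (hMc : 0 ≤ M + c) (hr : 0 ≤ r) (hrδ : r ≤ δ) :
    φ '' cthickening r K ⊆ cthickening ((M + c) * r) (φ '' K) := by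
  rintro _ ⟨y, hy, rfl⟩
  rw [hK.cthickening_eq_biUnion_closedBall hr] at hy
  obtain ⟨x, hx, hyx⟩ := mem_iUnion₂.1 hy
  refine mem_cthickening_of_dist_le _ (φ x) _ _ (mem_image_of_mem _ hx) ?_
  have h := happrox x hx y (closedBall_subset_closedBall hrδ hyx) x
    (mem_closedBall_self (hr.trans hrδ))
  rw [mem_closedBall, dist_eq_norm] at hyx
  calc dist (φ y) (φ x) = ‖(φ y - φ x - φ' x (y - x)) + φ' x (y - x)‖ := by
        rw [dist_eq_norm, sub_add_cancel]
    _ ≤ c * ‖y - x‖ + s x * ‖y - x‖ := (norm_add_le _ _).trans (add_le_add h (hconf x hx _).le)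
    _ ≤ (M + c) * ‖y - x‖ := by
        rw [add_comm, ← add_mul]
        gcongr
        exact hM x hx
    _ ≤ (M + c) * r := by gcongr

variable [FiniteDimensional ℝ E]

theorem surjective_of_norm_map_eq_mul {f : E →L[ℝ] E} {a : ℝ} (ha : 0 < a)
    (hf : ∀ v, ‖f v‖ = a * ‖v‖) : Function.Surjective f := by
  refine (LinearMap.injective_iff_surjective (f := (f : E →ₗ[ℝ] E))).1 ?_
  refine (injective_iff_map_eq_zero (f : E →ₗ[ℝ] E)).2 fun v hv => ?_
  have h := hf v
  rw [show f v = 0 from hv, norm_zero] at h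
  exact norm_eq_zero.1 ((mul_eq_zero.1 h.symm).resolve_left ha.ne')

theorem image_closedBall_of_norm_map_eq_mul {f : E →L[ℝ] E} {a : ℝ} (ha : 0 < a)
    (hf : ∀ v, ‖f v‖ = a * ‖v‖) (r : ℝ) : f '' closedBall 0 r = closedBall 0 (a * r) := by
  ext w
  constructor
  · rintro ⟨v, hv, rfl⟩
    rw [mem_closedBall_zero_iff] at hv ⊢
    rw [hf]
    gcongr
  · intro hw
    obtain ⟨v, rfl⟩ := surjective_of_norm_map_eq_mul ha hf w
    rw [mem_closedBall_zero_iff, hf] at hw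
    exact ⟨v, mem_closedBall_zero_iff.2 (le_of_mul_le_mul_left hw ha), rfl⟩

theorem abs_det_of_norm_map_eq_mul {f : E →L[ℝ] E} {a : ℝ} (ha : 0 < a)
    (hf : ∀ v, ‖f v‖ = a * ‖v‖) : |f.det| = a ^ Module.finrank ℝ E := by
  borelize E
  have h := Measure.addHaar_image_continuousLinearMap Measure.addHaar f (closedBall 0 1)
  rw [image_closedBall_of_norm_map_eq_mul ha hf, mul_one,
    Measure.addHaar_closedBall' _ _ ha.le] at h
  have h0 : (Measure.addHaar : Measure E) (closedBall 0 1) ≠ 0 :=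
    (measure_closedBall_pos _ _ one_pos).ne'
  have htop : (Measure.addHaar : Measure E) (closedBall 0 1) ≠ ⊤ := measure_closedBall_lt_top.ne
  rw [ENNReal.mul_left_inj h0 htop,
    ENNReal.ofReal_eq_ofReal_iff (by positivity) (abs_nonneg _)] at h
  exact h.symm

theorem exists_approximatesLinearOn_closedBall {φ : E → E} {φ' : E → E →L[ℝ] E} {G K : Set E}
    (hG : IsOpen G) (hK : IsCompact K) (hKG : K ⊆ G) (hderiv : ∀ x ∈ G, HasFDerivAt φ (φ' x) x)
    (hcont : ContinuousOn φ' G) {c : ℝ≥0} (hc : 0 < c) :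
    ∃ δ > 0, cthickening δ K ⊆ G ∧ ∀ x ∈ K, ApproximatesLinearOn φ (φ' x) (closedBall x δ) c ∧
      ∀ y ∈ closedBall x δ, ‖φ' y - φ' x‖ ≤ c := by
  obtain ⟨δ₀, hδ₀, hsub⟩ := hK.exists_cthickening_subset_open hG hKG
  obtain ⟨δ₁, hδ₁, huc⟩ := Metric.uniformContinuousOn_iff_le.1
    (hK.cthickening.uniformContinuousOn_of_continuous (hcont.mono hsub)) c (by exact_mod_cast hc)
  have hball : ∀ x ∈ K, closedBall x (min δ₀ δ₁) ⊆ cthickening δ₀ K := fun x hx =>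
    (closedBall_subset_closedBall (min_le_left _ _)).trans (closedBall_subset_cthickening hx _)
  have hbound : ∀ x ∈ K, ∀ y ∈ closedBall x (min δ₀ δ₁), ‖φ' y - φ' x‖ ≤ c := by
    intro x hx y hy
    rw [← dist_eq_norm]
    exact huc y (hball x hx hy) x (self_subset_cthickening _ hx)
      ((mem_closedBall.1 hy).trans (min_le_right _ _))
  refine ⟨min δ₀ δ₁, lt_min hδ₀ hδ₁, (cthickening_mono (min_le_left _ _) _).trans hsub,
    fun x hx => ⟨fun y hy z hz => ?_, hbound x hx⟩⟩
  exact (convex_closedBall x _).norm_image_sub_le_of_norm_hasFDerivWithin_le'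
    (fun w hw => (hderiv w (hsub (hball x hx hw))).hasFDerivWithinAt) (hbound x hx) hz hy

theorem cthickening_image_subset_image_cthickening {φ : E → E} {φ' : E → E →L[ℝ] E}
    {s : E → ℝ} {K : Set E} (hK : IsCompact K) (hφ : ContinuousOn φ K) {c : ℝ≥0} {δ r m : ℝ}
    (happrox : ∀ x ∈ K, ApproximatesLinearOn φ (φ' x) (closedBall x δ) c)
    (hconf : ∀ x ∈ K, ∀ v, ‖φ' x v‖ = s x * ‖v‖) (hm0 : 0 < m) (hm : ∀ x ∈ K, m ≤ s x)
    (hmc : c ≤ m) (hr : 0 ≤ r) (hrδ : r ≤ δ) :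
    cthickening ((m - c) * r) (φ '' K) ⊆ φ '' cthickening r K := by
  intro y hy
  rw [(hK.image_of_continuousOn hφ).cthickening_eq_biUnion_closedBall
    (mul_nonneg (sub_nonneg.2 hmc) hr)] at hy
  obtain ⟨_, ⟨x, hx, rfl⟩, hyx⟩ := mem_iUnion₂.1 hy
  have hsx : 0 < s x := hm0.trans_le (hm x hx)
  have hsurj := surjective_of_norm_map_eq_mul hsx (hconf x hx)
  let g : (φ' x).NonlinearRightInverse :=
    { toFun := Function.surjInv hsurj
      nnnorm := m.toNNReal⁻¹
      bound' := fun w => by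
        have h := hconf x hx (Function.surjInv hsurj w)
        rw [Function.surjInv_eq hsurj] at h
        rw [NNReal.coe_inv, Real.coe_toNNReal _ hm0.le, inv_mul_eq_div, le_div_iff₀ hm0, h,
          mul_comm]
        exact mul_le_mul_of_nonneg_right (hm x hx) (norm_nonneg _)
      right_inv' := Function.surjInv_eq hsurj }
  have hg : ((g.nnnorm : ℝ)⁻¹ - c) = m - c := by
    simp [g, hm0.le]
  have himage := (happrox x hx).surjOn_closedBall_of_nonlinearRightInverse g hr
    (closedBall_subset_closedBall hrδ)
  rw [hg] at himage
  exact image_mono (closedBall_subset_cthickening hx r) (himage hyx)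

end Conformal

section Volume

variable {E : Type*} [NormedAddCommGroup E] [NormedSpace ℝ E] [FiniteDimensional ℝ E]
  [MeasurableSpace E] [BorelSpace E] (μ : Measure E) [μ.IsAddHaarMeasure]
  {φ : E → E} {φ' : E → E →L[ℝ] E} {s : E → ℝ} {A : Set E}

theorem addHaar_image_eq_lintegral_of_norm_map_eq_mul (hA : MeasurableSet A)
    (hderiv : ∀ x ∈ A, HasFDerivAt φ (φ' x) x) (hinj : InjOn φ A) (hs : ∀ x ∈ A, 0 < s x)
    (hconf : ∀ x ∈ A, ∀ v, ‖φ' x v‖ = s x * ‖v‖) :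
    μ (φ '' A) = ∫⁻ x in A, ENNReal.ofReal (s x ^ Module.finrank ℝ E) ∂μ := by
  rw [← lintegral_abs_det_fderiv_eq_addHaar_image μ hA
    (fun x hx => (hderiv x hx).hasFDerivWithinAt) hinj]
  exact setLIntegral_congr_fun hA fun x hx => by
    rw [abs_det_of_norm_map_eq_mul (hs x hx) (hconf x hx)]

theorem addHaar_image_le_of_norm_map_eq_mul (hA : MeasurableSet A)
    (hderiv : ∀ x ∈ A, HasFDerivAt φ (φ' x) x) (hinj : InjOn φ A) (hs : ∀ x ∈ A, 0 < s x)
    (hconf : ∀ x ∈ A, ∀ v, ‖φ' x v‖ = s x * ‖v‖) {b : ℝ} (hb : ∀ x ∈ A, s x ≤ b) :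
    μ (φ '' A) ≤ ENNReal.ofReal (b ^ Module.finrank ℝ E) * μ A := by
  rw [addHaar_image_eq_lintegral_of_norm_map_eq_mul μ hA hderiv hinj hs hconf,
    ← setLIntegral_const]
  exact setLIntegral_mono' hA fun x hx =>
    ENNReal.ofReal_le_ofReal (pow_le_pow_left₀ (hs x hx).le (hb x hx) _)

theorem le_addHaar_image_of_norm_map_eq_mul (hA : MeasurableSet A)
    (hderiv : ∀ x ∈ A, HasFDerivAt φ (φ' x) x) (hinj : InjOn φ A) (hs : ∀ x ∈ A, 0 < s x)
    (hconf : ∀ x ∈ A, ∀ v, ‖φ' x v‖ = s x * ‖v‖) {a : ℝ} (ha0 : 0 ≤ a)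
    (ha : ∀ x ∈ A, a ≤ s x) :
    ENNReal.ofReal (a ^ Module.finrank ℝ E) * μ A ≤ μ (φ '' A) := by
  rw [addHaar_image_eq_lintegral_of_norm_map_eq_mul μ hA hderiv hinj hs hconf,
    ← setLIntegral_const]
  exact setLIntegral_mono' hA fun x hx =>
    ENNReal.ofReal_le_ofReal (pow_le_pow_left₀ ha0 (ha x hx) _)

end Volume

theorem map_mul_left_nhdsGT_zero {a : ℝ} (ha : 0 < a) : map (a * ·) (𝓝[>] 0) = 𝓝[>] 0 := by
  conv_lhs => rw [← comap_mulLeft_nhdsGT_zero ha]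
  exact map_comap_of_surjective (mul_left_surjective₀ ha.ne') _

theorem contApprox_mul (n : ℕ) (d : ℝ) (S : Set (EuclideanSpace ℝ (Fin n))) {a r : ℝ}
    (ha : 0 < a) (hr : 0 < r) :
    contApprox n d S (a * r) = ENNReal.ofReal (a ^ (d - (n : ℝ))) *
      (ENNReal.ofReal (r ^ (d - (n : ℝ))) * volume (cthickening (a * r) S)) := by
  rw [contApprox, Real.mul_rpow ha.le hr.le, ENNReal.ofReal_mul (by positivity), mul_assoc]

theorem upperCont_le_of_eventually_volume_le {n : ℕ} (d : ℝ)
    {S T : Set (EuclideanSpace ℝ (Fin n))} {a b : ℝ} (ha : 0 < a) (hb : 0 ≤ b)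
    (h : ∀ᶠ r in 𝓝[>] (0 : ℝ),
      volume (cthickening (a * r) T) ≤ ENNReal.ofReal b * volume (cthickening r S)) :
    upperCont n d T ≤ ENNReal.ofReal (b * a ^ (d - (n : ℝ))) * upperCont n d S := by
  rw [upperCont, upperCont, ← ENNReal.limsup_const_mul_of_ne_top ENNReal.ofReal_ne_top,
    ← map_mul_left_nhdsGT_zero ha, ← Filter.limsup_comp, map_mul_left_nhdsGT_zero ha]
  refine limsup_le_limsup ?_
  filter_upwards [h, self_mem_nhdsWithin] with r hr hr0
  rw [Function.comp_apply, contApprox_mul n d T ha hr0, contApprox, ENNReal.ofReal_mul hb]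
  grw [hr]
  exact le_of_eq (by ring)

theorem le_lowerCont_of_eventually_le_volume {n : ℕ} (d : ℝ)
    {S T : Set (EuclideanSpace ℝ (Fin n))} {a b : ℝ} (ha : 0 < a) (hb : 0 ≤ b)
    (h : ∀ᶠ r in 𝓝[>] (0 : ℝ),
      ENNReal.ofReal b * volume (cthickening r S) ≤ volume (cthickening (a * r) T)) :
    ENNReal.ofReal (b * a ^ (d - (n : ℝ))) * lowerCont n d S ≤ lowerCont n d T := by
  have hT : lowerCont n d T = liminf (contApprox n d T ∘ (a * ·)) (𝓝[>] 0) := by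
    rw [lowerCont, Filter.liminf_comp, map_mul_left_nhdsGT_zero ha]
  rw [hT, lowerCont, ← ENNReal.liminf_const_mul_of_ne_top ENNReal.ofReal_ne_top]
  refine liminf_le_liminf ?_
  filter_upwards [h, self_mem_nhdsWithin] with r hr hr0
  rw [Function.comp_apply, contApprox_mul n d T ha hr0, contApprox, ENNReal.ofReal_mul hb]
  grw [← hr]
  exact le_of_eq (by ring)

/-- two-sided bounds for the Minkowski contents of the image of a compact set
under an injective conformal `C¹` map, in terms of `m_K = min_K |φ'|` and `M_K = max_K |φ'|`. -/
theorem cont_image_conformal_bounds (n : ℕ) (hn : 1 ≤ n) (d : ℝ)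
    (hd0 : 0 < d) (hdn : d < n)
    (G : Set (EuclideanSpace ℝ (Fin n))) (hG : IsOpen G)
    (φ : EuclideanSpace ℝ (Fin n) → EuclideanSpace ℝ (Fin n))
    (φ' : EuclideanSpace ℝ (Fin n) → (EuclideanSpace ℝ (Fin n) →L[ℝ] EuclideanSpace ℝ (Fin n)))
    (s : EuclideanSpace ℝ (Fin n) → ℝ)
    (hinj : InjOn φ G)
    (hderiv : ∀ x ∈ G, HasFDerivAt φ (φ' x) x)
    (hderiv_cont : ContinuousOn φ' G)
    (hs_pos : ∀ x ∈ G, 0 < s x)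
    (hconf : ∀ x ∈ G, ∀ v : EuclideanSpace ℝ (Fin n), ‖φ' x v‖ = s x * ‖v‖)
    (K : Set (EuclideanSpace ℝ (Fin n))) (hK : IsCompact K) (hKne : K.Nonempty) (hKG : K ⊆ G)
    (mK MK : ℝ) (hm : IsLeast (s '' K) mK) (hM : IsGreatest (s '' K) MK) :
    ENNReal.ofReal (mK ^ n * MK ^ (d - (n : ℝ))) * lowerCont n d K ≤ lowerCont n d (φ '' K) ∧
    lowerCont n d (φ '' K) ≤ upperCont n d (φ '' K) ∧
    upperCont n d (φ '' K) ≤ ENNReal.ofReal (MK ^ n * mK ^ (d - (n : ℝ))) * upperCont n d K := by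
  have : Nonempty (Fin n) := ⟨⟨0, hn⟩⟩
  have hm0 : 0 < mK := by
    obtain ⟨x, hx, rfl⟩ := hm.1
    exact hs_pos x (hKG hx)
  have hmM : mK ≤ MK := hm.2 hM.1
  have hsm : ∀ x ∈ K, mK ≤ s x := fun x hx => hm.2 (mem_image_of_mem s hx)
  have hsM : ∀ x ∈ K, s x ≤ MK := fun x hx => hM.2 (mem_image_of_mem s hx)
  have hbounds : ∀ c : ℝ, 0 < c → c < mK →
      ENNReal.ofReal ((mK - c) ^ n * (MK + c) ^ (d - (n : ℝ))) * lowerCont n d K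
        ≤ lowerCont n d (φ '' K) ∧
      upperCont n d (φ '' K)
        ≤ ENNReal.ofReal ((MK + c) ^ n * (mK - c) ^ (d - (n : ℝ))) * upperCont n d K := by
    intro c hc hcm
    lift c to ℝ≥0 using hc.le
    obtain ⟨δ, hδ, hδG, happrox⟩ := exists_approximatesLinearOn_closedBall hG hK hKG hderiv
      hderiv_cont (NNReal.coe_pos.1 hc)
    have hconfK : ∀ x ∈ K, ∀ v, ‖φ' x v‖ = s x * ‖v‖ := fun x hx => hconf x (hKG hx)
    have hφK : ContinuousOn φ K := fun x hx =>
      (hderiv x (hKG hx)).continuousAt.continuousWithinAt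
    have hs_near : ∀ r, 0 < r → r ≤ δ → ∀ y ∈ cthickening r K, mK - c ≤ s y ∧ s y ≤ MK + c := by
      intro r hr hrδ y hy
      have hyG : y ∈ G := hδG (cthickening_mono hrδ _ hy)
      rw [hK.cthickening_eq_biUnion_closedBall hr.le] at hy
      obtain ⟨x, hx, hyx⟩ := mem_iUnion₂.1 hy
      have h := abs_le.1 ((abs_sub_le_norm_sub_of_norm_map_eq_mul (hconf y hyG)
        (hconfK x hx)).trans
        ((happrox x hx).2 y (closedBall_subset_closedBall hrδ hyx)))
      constructor <;> linarith [hsm x hx, hsM x hx]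
    have hsmall : ∀ᶠ r in 𝓝[>] (0 : ℝ), 0 < r ∧ r ≤ δ := by
      filter_upwards [Ioc_mem_nhdsGT hδ] with r hr using hr
    constructor
    · refine le_lowerCont_of_eventually_le_volume d (by linarith) (pow_nonneg (by linarith) n) ?_
      filter_upwards [hsmall] with r ⟨hr, hrδ⟩
      have hsub : cthickening r K ⊆ G := (cthickening_mono hrδ _).trans hδG
      have h := le_addHaar_image_of_norm_map_eq_mul volume (isClosed_cthickening.measurableSet)
        (fun x hx => hderiv x (hsub hx)) (hinj.mono hsub) (fun x hx => hs_pos x (hsub hx))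
        (fun x hx => hconf x (hsub hx)) (sub_nonneg.2 hcm.le)
        (fun x hx => (hs_near r hr hrδ x hx).1)
      rw [finrank_euclideanSpace_fin] at h
      exact h.trans (measure_mono (image_cthickening_subset_cthickening hK
        (fun x hx => (happrox x hx).1) hconfK hsM (by linarith) hr.le hrδ))
    · refine upperCont_le_of_eventually_volume_le d (by linarith) (pow_nonneg (by linarith) n) ?_
      filter_upwards [hsmall] with r ⟨hr, hrδ⟩
      have hsub : cthickening r K ⊆ G := (cthickening_mono hrδ _).trans hδG
      have h := addHaar_image_le_of_norm_map_eq_mul volume (isClosed_cthickening.measurableSet)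
        (fun x hx => hderiv x (hsub hx)) (hinj.mono hsub) (fun x hx => hs_pos x (hsub hx))
        (fun x hx => hconf x (hsub hx)) (fun x hx => (hs_near r hr hrδ x hx).2)
      rw [finrank_euclideanSpace_fin] at h
      exact (measure_mono (cthickening_image_subset_image_cthickening hK hφK
        (fun x hx => (happrox x hx).1) hconfK hm0 hsm hcm.le hr.le hrδ)).trans h
  have hM0 : 0 < MK := hm0.trans_le hmM
  have hsmall : ∀ᶠ c in 𝓝[>] (0 : ℝ), 0 < c ∧ c < mK := Ioo_mem_nhdsGT hm0
  have hsub : Tendsto (fun c : ℝ => mK - c) (𝓝[>] 0) (𝓝 mK) :=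
    (Continuous.tendsto' (by fun_prop) 0 mK (sub_zero mK)).mono_left nhdsWithin_le_nhds
  have hadd : Tendsto (fun c : ℝ => MK + c) (𝓝[>] 0) (𝓝 MK) :=
    (Continuous.tendsto' (by fun_prop) 0 MK (add_zero MK)).mono_left nhdsWithin_le_nhds
  refine ⟨?_, liminf_le_limsup, ?_⟩
  · refine le_of_tendsto (ENNReal.Tendsto.mul_const (ENNReal.tendsto_ofReal
      ((hsub.pow n).mul (hadd.rpow_const (Or.inl hM0.ne')))) (Or.inl ?_))
      (hsmall.mono fun c hc => (hbounds c hc.1 hc.2).1)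
    exact (ENNReal.ofReal_pos.2 (by positivity)).ne'
  · refine ge_of_tendsto (ENNReal.Tendsto.mul_const (ENNReal.tendsto_ofReal
      ((hadd.pow n).mul (hsub.rpow_const (Or.inl hm0.ne')))) (Or.inl ?_))
      (hsmall.mono fun c hc => (hbounds c hc.1 hc.2).2)
    exact (ENNReal.ofReal_pos.2 (by positivity)).ne'
end
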